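/- Let A = {1,…,k} with k ≥ 3, and let S be the set of gates 1-SWAP_{a,b} for all a ≠ b ∈ A. Then ⟨S⟩ = CONS, the class of all conservative reversible gates over A. -/

import Mathlib

/-- A reversible gate function of arity `n` over alphabet `A`: a bijection `A^n → A^n`. -/
abbrev GateFun (A : Type*) (n : ℕ) := (Fin n → A) ≃ (Fin n → A)

/-- A reversible gate over alphabet `A`: an arity together with a bijection of that arity. -/
abbrev Gate (A : Type*) := Σ n : ℕ, GateFun A n

/-- The canonical identification `A^{n+m} ≃ A^n × A^m`. -/
def splitEquiv (A : Type*) (n m : ℕ) :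
    (Fin (n + m) → A) ≃ ((Fin n → A) × (Fin m → A)) :=
  (Equiv.arrowCongr finSumFinEquiv.symm (Equiv.refl A)).trans
    (Equiv.sumArrowEquivProdArrow _ _ A)

/-- The permutation gate `P_σ`, mapping `(a_1,…,a_n)` to `(a_{σ(1)},…,a_{σ(n)})`. -/
def permGate (A : Type*) {n : ℕ} (σ : Equiv.Perm (Fin n)) : GateFun A n :=
  Equiv.arrowCongr σ.symm (Equiv.refl A)

/-- Tensor product of gates. -/
def tensorGate {A : Type*} {n m : ℕ} (F : GateFun A n) (G : GateFun A m) :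
    GateFun A (n + m) :=
  ((splitEquiv A n m).trans (F.prodCongr G)).trans (splitEquiv A n m).symm

/-- The generation relation: `Generates S g` means `g` can be generated from the set `S`
of reversible gates using the permutation, tensor product, composition and ancilla rules. -/
inductive Generates {A : Type*} (S : Set (Gate A)) : Gate A → Prop
  | mem {g : Gate A} : g ∈ S → Generates S g
  | perm (n : ℕ) (σ : Equiv.Perm (Fin n)) : Generates S ⟨n, permGate A σ⟩
  | tensor {n m : ℕ} {F : GateFun A n} {G : GateFun A m} :
      Generates S ⟨n, F⟩ → Generates S ⟨m, G⟩ → Generates S ⟨n + m, tensorGate F G⟩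
  | comp {n : ℕ} {F G : GateFun A n} :
      Generates S ⟨n, F⟩ → Generates S ⟨n, G⟩ → Generates S ⟨n, G.trans F⟩
  | ancilla {l m : ℕ} {F : GateFun A (l + m)} (a : Fin l → A) {F' : GateFun A m} :
      Generates S ⟨l + m, F⟩ →
      (∀ b : Fin m → A,
        F ((splitEquiv A l m).symm (a, b)) = (splitEquiv A l m).symm (a, F' b)) →
      Generates S ⟨m, F'⟩

/-- The gate class `⟨S⟩` generated by a set `S` of reversible gates. -/
def genClosure {A : Type*} (S : Set (Gate A)) : Set (Gate A) := {g | Generates S g}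

/-- A reversible gate class: a set of gates closed under the generation rules. -/
def IsGateClass {A : Type*} (S : Set (Gate A)) : Prop := ∀ g, Generates S g → g ∈ S

/-- The transposition gate `τ_{u,v}` exchanging the inputs `u` and `v`. -/
def tau {A : Type*} [DecidableEq A] {n : ℕ} (u v : Fin n → A) : GateFun A n :=
  Equiv.swap u v

/-- The controlled gate `w-F`, mapping `w u` to `w F(u)` and fixing all other inputs. -/
def controlled {A : Type*} [DecidableEq A] {l n : ℕ} (w : Fin l → A) (F : GateFun A n) :
    GateFun A (l + n) :=
  ((splitEquiv A l n).trans
    (Equiv.prodCongrRight fun p => if p = w then F else Equiv.refl _)).trans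
    (splitEquiv A l n).symm

/-- `SWAP_{a,b}` for single symbols `a`, `b`: exchanges `ab` and `ba`. -/
def swapGate {A : Type*} [DecidableEq A] (a b : A) : GateFun A 2 :=
  tau ![a, b] ![b, a]

/-- Number of occurrences of the symbol `a` in the string `x`. -/
def countOf {A : Type*} [DecidableEq A] {n : ℕ} (a : A) (x : Fin n → A) : ℕ :=
  (Finset.univ.filter fun i => x i = a).card

section Split

variable {A : Type*} {n m : ℕ}

theorem splitEquiv_symm_castAdd (p : (Fin n → A) × (Fin m → A)) (i : Fin n) :
    (splitEquiv A n m).symm p (Fin.castAdd m i) = p.1 i := by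
  obtain ⟨x, y⟩ := p
  simp [splitEquiv]

theorem splitEquiv_symm_natAdd (p : (Fin n → A) × (Fin m → A)) (i : Fin m) :
    (splitEquiv A n m).symm p (Fin.natAdd n i) = p.2 i := by
  obtain ⟨x, y⟩ := p
  simp [splitEquiv]

theorem splitEquiv_fst (x : Fin (n + m) → A) :
    (splitEquiv A n m x).1 = x ∘ Fin.castAdd m := by
  ext; simp [splitEquiv]

theorem splitEquiv_snd (x : Fin (n + m) → A) :
    (splitEquiv A n m x).2 = x ∘ Fin.natAdd n := by
  ext; simp [splitEquiv]

end Split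

section Counting

variable {A : Type*} [DecidableEq A]

theorem countOf_eq_sum {n : ℕ} (a : A) (x : Fin n → A) :
    countOf a x = ∑ i, if x i = a then 1 else 0 := by
  simp [countOf]

theorem countOf_splitEquiv_symm {n m : ℕ} (a : A) (p : (Fin n → A) × (Fin m → A)) :
    countOf a ((splitEquiv A n m).symm p) = countOf a p.1 + countOf a p.2 := by
  simp only [countOf_eq_sum, Fin.sum_univ_add, splitEquiv_symm_castAdd, splitEquiv_symm_natAdd]

theorem countOf_comp_perm {n : ℕ} (a : A) (x : Fin n → A) (σ : Equiv.Perm (Fin n)) :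
    countOf a (x ∘ σ) = countOf a x := by
  simp only [countOf_eq_sum, Function.comp_apply]
  exact Equiv.sum_comp σ fun i => if x i = a then 1 else 0

theorem exists_perm_of_countOf_eq {n : ℕ} {x y : Fin n → A}
    (h : ∀ a, countOf a x = countOf a y) : ∃ σ : Equiv.Perm (Fin n), y ∘ σ = x := by
  have e (a : A) : Nonempty ({i // x i = a} ≃ {i // y i = a}) := by
    rw [← Fintype.card_eq, Fintype.card_subtype, Fintype.card_subtype]
    exact h a
  exact ⟨Equiv.ofFiberEquiv fun a => (e a).some,
    funext fun i => Equiv.ofFiberEquiv_map (fun a => (e a).some) i⟩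

/-- A gate that preserves the number of occurrences of every symbol. -/
def IsConservative (g : Gate A) : Prop :=
  ∀ (x : Fin g.1 → A) (a : A), countOf a (g.2 x) = countOf a x

theorem countOf_swapGate (a b c : A) (x : Fin 2 → A) :
    countOf c (swapGate a b x) = countOf c x := by
  have h : countOf c ![a, b] = countOf c ![b, a] := by
    simp only [countOf_eq_sum, Fin.sum_univ_two, Matrix.cons_val_zero, Matrix.cons_val_one]
    exact add_comm _ _
  unfold swapGate tau
  rw [Equiv.swap_apply_def]
  split_ifs with h₁ h₂ <;> simp [*]

theorem isConservative_controlled {l n : ℕ} (w : Fin l → A) {F : GateFun A n}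
    (hF : IsConservative ⟨n, F⟩) : IsConservative ⟨l + n, controlled w F⟩ := by
  intro x a
  obtain ⟨p, rfl⟩ := (splitEquiv A l n).symm.surjective x
  obtain ⟨p, q⟩ := p
  simp only [controlled, Equiv.trans_apply, Equiv.apply_symm_apply, countOf_splitEquiv_symm,
    Equiv.prodCongrRight_apply]
  split_ifs
  · rw [hF]
  · rfl

theorem Generates.isConservative {S : Set (Gate A)} (hS : ∀ g ∈ S, IsConservative g)
    {g : Gate A} (hg : Generates S g) : IsConservative g := by
  induction hg with
  | mem h => exact hS _ h
  | perm n σ => exact fun x a => countOf_comp_perm a x σ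
  | tensor _ _ hF hG =>
    intro x a
    obtain ⟨p, rfl⟩ := (splitEquiv A _ _).symm.surjective x
    have h₁ := hF p.1 a
    have h₂ := hG p.2 a
    simp_all [tensorGate, countOf_splitEquiv_symm]
  | comp _ _ hF hG => exact fun x a => (hF _ a).trans (hG x a)
  | ancilla w _ h hF =>
    intro x a
    have h₁ := hF ((splitEquiv A _ _).symm (w, x)) a
    simp only [h, countOf_splitEquiv_symm] at h₁
    exact Nat.add_left_cancel h₁

end Counting

open Equiv in
/-- A bijection of the states of finitely many wires, labelled by `ι`, that is generated by `S`
after some numbering of the wires. -/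
def GeneratedOn {A : Type*} (S : Set (Gate A)) {ι : Type} (F : Perm (ι → A)) : Prop :=
  ∃ (n : ℕ) (e : ι ≃ Fin n), Generates S ⟨n, (e.arrowCongr (Equiv.refl A)).permCongr F⟩

namespace GeneratedOn

open Equiv

variable {A : Type*} {S : Set (Gate A)} {ι κ : Type}

theorem generates {F : Perm (ι → A)} (hF : GeneratedOn S F) {n : ℕ} (e : ι ≃ Fin n) :
    Generates S ⟨n, (e.arrowCongr (Equiv.refl A)).permCongr F⟩ := by
  obtain ⟨m, f, h⟩ := hF
  obtain rfl : m = n := by simpa using Fintype.card_congr (f.symm.trans e)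
  convert! Generates.comp (.perm m (e.symm.trans f)) (.comp h (.perm m (f.symm.trans e))) using 2
  ext x i
  simp [permGate, Function.comp_def, Equiv.arrowCongr]

theorem of_generates {n : ℕ} {F : Perm (Fin n → A)} (h : Generates S ⟨n, F⟩) :
    GeneratedOn S F := ⟨n, Equiv.refl _, h⟩

theorem generates_fin {n : ℕ} {F : Perm (Fin n → A)} (h : GeneratedOn S F) :
    Generates S ⟨n, F⟩ := h.generates (Equiv.refl _)

theorem mul {F G : Perm (ι → A)} (hF : GeneratedOn S F) (hG : GeneratedOn S G) :
    GeneratedOn S (F * G) := by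
  obtain ⟨n, e, h⟩ := hF
  refine ⟨n, e, ?_⟩
  convert! Generates.comp h (hG.generates e) using 2
  ext x i
  simp

theorem one [Finite ι] : GeneratedOn S (1 : Perm (ι → A)) := by
  obtain ⟨n, ⟨e⟩⟩ := Finite.exists_equiv_fin ι
  refine ⟨n, e, ?_⟩
  convert! Generates.perm n (Equiv.refl _)
  ext x i
  simp [permGate]

theorem embed [Finite ι] {F : Perm (κ → A)} (hF : GeneratedOn S F) (f : κ ↪ ι)
    {G : Perm (ι → A)} (h : ∀ x, G x ∘ f = F (x ∘ f))
    (h' : ∀ x, ∀ i ∉ Set.range f, G x i = x i) : GeneratedOn S G := by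
  classical
  obtain ⟨n, e, hn⟩ := hF
  obtain ⟨m, ⟨c⟩⟩ := Finite.exists_equiv_fin ((Set.range f)ᶜ : Set ι)
  let d : ι ≃ Fin (n + m) := ((Equiv.Set.sumCompl (Set.range f)).symm.trans
    (((Equiv.ofInjective f f.injective).symm.trans e).sumCongr c)).trans finSumFinEquiv
  have hd₁ (i : κ) : d (f i) = Fin.castAdd m (e i) := by
    simp [d, Equiv.Set.sumCompl_symm_apply_of_mem]
  have hd₂ (i : Fin n) : d.symm (Fin.castAdd m i) = f (e.symm i) := by
    rw [Equiv.symm_apply_eq, hd₁, Equiv.apply_symm_apply]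
  have hd₃ (i : Fin m) : d.symm (Fin.natAdd n i) ∉ Set.range f := by
    rintro ⟨j, hj⟩
    have := congrArg d hj
    rw [hd₁, Equiv.apply_symm_apply] at this
    have := congrArg Fin.val this
    simp at this
    omega
  refine ⟨n + m, d, ?_⟩
  convert! Generates.tensor hn (Generates.perm m (Equiv.refl _)) using 2
  ext x i
  induction i using Fin.addCases with
  | left i =>
    have hx : (x ∘ d) ∘ f = (x ∘ Fin.castAdd m) ∘ e := funext fun j => by simp [hd₁]
    have := congrFun (h (x ∘ d)) (e.symm i)
    simp only [Function.comp_apply] at this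
    simp [tensorGate, splitEquiv_symm_castAdd, hd₂, Equiv.arrowCongr, this, splitEquiv_fst, hx]
  | right i =>
    simp [tensorGate, splitEquiv_symm_natAdd, Equiv.arrowCongr, h' _ _ (hd₃ i), permGate,
      splitEquiv_snd]

theorem ancilla [Finite ι] {F : Perm (ι → A)} (hF : GeneratedOn S F) (f : κ ↪ ι) (w : ι → A)
    {G : Perm (κ → A)} (h : ∀ x, (∀ i ∉ Set.range f, x i = w i) →
      F x ∘ f = G (x ∘ f) ∧ ∀ i ∉ Set.range f, F x i = x i) : GeneratedOn S G := by
  classical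
  have := Finite.of_injective f f.injective
  obtain ⟨m, ⟨e⟩⟩ := Finite.exists_equiv_fin κ
  obtain ⟨l, ⟨c⟩⟩ := Finite.exists_equiv_fin ((Set.range f)ᶜ : Set ι)
  let d : ι ≃ Fin (l + m) := ((Equiv.Set.sumCompl (Set.range f)).symm.trans
    (((Equiv.ofInjective f f.injective).symm.trans e).sumCongr c)).trans
    ((Equiv.sumComm _ _).trans finSumFinEquiv)
  have hd₁ (i : κ) : d (f i) = Fin.natAdd l (e i) := by
    simp [d, Equiv.Set.sumCompl_symm_apply_of_mem]
  have hd₂ (i : Fin m) : d.symm (Fin.natAdd l i) = f (e.symm i) := by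
    rw [Equiv.symm_apply_eq, hd₁, Equiv.apply_symm_apply]
  have hd₃ (i : Fin l) : d.symm (Fin.castAdd m i) ∉ Set.range f := by
    rintro ⟨j, hj⟩
    have := congrArg d hj
    rw [hd₁, Equiv.apply_symm_apply] at this
    have := congrArg Fin.val this
    simp at this
    omega
  refine ⟨m, e, Generates.ancilla (fun i => w (d.symm (Fin.castAdd m i))) (hF.generates d) ?_⟩
  intro b
  set y := (splitEquiv A l m).symm (fun i => w (d.symm (Fin.castAdd m i)), b)
  obtain ⟨hy₁, hy₂⟩ := h (y ∘ d) fun i hi => by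
    obtain ⟨j, rfl⟩ := d.symm.surjective i
    induction j using Fin.addCases with
    | left j => simp [y, splitEquiv_symm_castAdd]
    | right j => exact absurd ⟨_, (hd₂ j).symm⟩ hi
  ext i
  induction i using Fin.addCases with
  | left i =>
    simp [Equiv.arrowCongr, splitEquiv_symm_castAdd, hy₂ _ (hd₃ i), y]
  | right i =>
    have hx : (y ∘ d) ∘ f = b ∘ e := funext fun j => by simp [hd₁, y, splitEquiv_symm_natAdd]
    have := congrFun hy₁ (e.symm i)
    simp only [Function.comp_apply] at this
    simp [splitEquiv_symm_natAdd, hd₂, Equiv.arrowCongr, this, hx]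

theorem inv [Finite ι] [Finite A] {F : Perm (ι → A)} (hF : GeneratedOn S F) :
    GeneratedOn S F⁻¹ := by
  have hpow (n : ℕ) : GeneratedOn S (F ^ n) := by
    induction n with
    | zero => exact one
    | succ n ih => exact pow_succ F n ▸ ih.mul hF
  rw [← one_mul F⁻¹, ← pow_one F, ← pow_orderOf_eq_one F, ← pow_sub F (orderOf_pos F)]
  exact hpow _

end GeneratedOn

section CondSwap

open Equiv Function

variable {A : Type*} {S : Set (Gate A)} {ι κ ι' κ' : Type}

open Classical in
/-- Exchange the symbols `a` and `b` on the two wires `f (inr false)` and `f (inr true)`, provided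
that these wires carry `a` and `b` in some order and that the wires `f (inl _)` satisfy `Q`. -/
noncomputable def condSwap (Q : (κ → A) → Prop) (f : κ ⊕ Bool ↪ ι) (a b : A) : Perm (ι → A) :=
  Involutive.toPerm
    (fun x => if Q (x ∘ f ∘ Sum.inl) ∧ s(x (f (.inr false)), x (f (.inr true))) = s(a, b)
      then x ∘ swap (f (.inr false)) (f (.inr true)) else x) <| by
    intro x
    have h : (x ∘ swap (f (.inr false)) (f (.inr true))) ∘ f ∘ Sum.inl = x ∘ f ∘ Sum.inl := by
      ext i
      simp [swap_apply_of_ne_of_ne]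
    by_cases hx : Q (x ∘ f ∘ Sum.inl) ∧ s(x (f (.inr false)), x (f (.inr true))) = s(a, b)
    · simp only [if_pos hx, h]
      rw [if_pos]
      · ext; simp
      · simpa [Sym2.eq_swap (a := x (f (.inr true)))] using hx
    · simp only [if_neg hx]

open Classical in
theorem condSwap_apply [DecidableEq ι] (Q : (κ → A) → Prop) (f : κ ⊕ Bool ↪ ι) (a b : A) (x : ι → A) :
    condSwap Q f a b x =
      if Q (x ∘ f ∘ Sum.inl) ∧ s(x (f (.inr false)), x (f (.inr true))) = s(a, b)
      then x ∘ swap (f (.inr false)) (f (.inr true)) else x := by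
  obtain rfl : ‹DecidableEq ι› = fun _ _ => Classical.propDecidable _ := Subsingleton.elim _ _
  rfl

theorem condSwap_apply_of_ne (Q : (κ → A) → Prop) (f : κ ⊕ Bool ↪ ι) (a b : A) (x : ι → A)
    {i : ι} (hi : ∀ c, i ≠ f (.inr c)) : condSwap Q f a b x i = x i := by
  classical
  rw [condSwap_apply]
  split_ifs
  · simp [swap_apply_of_ne_of_ne, hi]
  · rfl

theorem condSwap_comp {Q : (κ → A) → Prop} {f : κ ⊕ Bool ↪ ι} {Q' : (κ' → A) → Prop}
    {f' : κ' ⊕ Bool ↪ ι'} (g : ι ↪ ι') (hf : ∀ c, f' (.inr c) = g (f (.inr c))) (a b : A)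
    {x : ι' → A} (hQ : Q' (x ∘ f' ∘ Sum.inl) ↔ Q ((x ∘ g) ∘ f ∘ Sum.inl)) :
    condSwap Q' f' a b x ∘ g = condSwap Q f a b (x ∘ g) := by
  classical
  simp only [condSwap_apply, hf]
  by_cases h : Q ((x ∘ g) ∘ f ∘ Sum.inl) ∧
    s((x ∘ g) (f (.inr false)), (x ∘ g) (f (.inr true))) = s(a, b)
  · rw [if_pos h, if_pos ⟨hQ.2 h.1, h.2⟩]
    ext i
    simp [g.swap_apply]
  · rw [if_neg h, if_neg fun h' => h ⟨hQ.1 h'.1, h'.2⟩]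

/-- The predicate `Q` on the state of the wires `κ` can serve as control of swaps generated
by `S`. -/
def Controls (S : Set (Gate A)) (Q : (κ → A) → Prop) : Prop :=
  ∀ a b, a ≠ b → GeneratedOn S (condSwap Q (Embedding.refl (κ ⊕ Bool)) a b)

namespace Controls

variable {Q : (κ → A) → Prop}

theorem generatedOn [Finite ι] (hQ : Controls S Q) (f : κ ⊕ Bool ↪ ι) {a b : A} (h : a ≠ b) :
    GeneratedOn S (condSwap Q f a b) :=
  (hQ a b h).embed f (fun _ => condSwap_comp f (fun _ => rfl) a b Iff.rfl) fun _ _ hi =>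
    condSwap_apply_of_ne _ _ _ _ _ fun _ hc => hi ⟨_, hc.symm⟩

theorem comp_embedding [Finite ι] (hQ : Controls S Q) (g : κ ↪ ι) :
    Controls S fun x => Q (x ∘ g) := fun a b h =>
  (hQ a b h).embed (g.sumMap (Embedding.refl Bool))
    (fun _ => condSwap_comp _ (fun _ => rfl) a b Iff.rfl) fun _ _ hi =>
    condSwap_apply_of_ne _ _ _ _ _ fun c hc => hi ⟨.inr c, hc.symm⟩

theorem comp_perm [Finite A] [Finite κ] (hQ : Controls S Q) {F : Perm (κ → A)}
    (hF : GeneratedOn S F) : Controls S fun x => Q (F x) := by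
  classical
  intro a b h
  let F' : Perm (κ ⊕ Bool → A) :=
    (sumArrowEquivProdArrow κ Bool A).symm.permCongr (F.prodCongr (Equiv.refl _))
  have hF₁ (x) : F' x ∘ Sum.inl = F (x ∘ Sum.inl) := rfl
  have hF₂ (x : κ ⊕ Bool → A) (c : Bool) : F' x (.inr c) = x (.inr c) := rfl
  have hF' : GeneratedOn S F' := hF.embed Embedding.inl hF₁ fun x i hi => by
    cases i with
    | inl i => exact absurd ⟨i, rfl⟩ hi
    | inr c => rfl
  convert (hF'.inv.mul (hQ a b h)).mul hF'
  rw [mul_assoc, eq_inv_mul_iff_mul_eq]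
  ext x i
  simp only [Perm.mul_apply, condSwap_apply, Embedding.refl_apply, hF₂]
  have hl (y : κ ⊕ Bool → A) : (y ∘ Embedding.refl _ ∘ Sum.inl) = y ∘ Sum.inl := rfl
  simp only [hl, hF₁]
  split_ifs
  · cases i with
    | inl i =>
      have (y : κ ⊕ Bool → A) : (y ∘ swap (.inr false) (.inr true)) ∘ Sum.inl = y ∘ Sum.inl := by
        ext; simp [swap_apply_of_ne_of_ne]
      have h₁ := congrFun (hF₁ (x ∘ swap (.inr false) (.inr true))) i
      have h₂ := congrFun (hF₁ x) i
      simp only [this, comp_apply] at h₁ h₂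
      simp [h₁, h₂, swap_apply_of_ne_of_ne]
    | inr c => cases c <;> simp [hF₂]
  · rfl

theorem ancilla [Finite ι] (g : κ ↪ ι) (w : ι → A) {R : (ι → A) → Prop} (hR : Controls S R)
    (h : ∀ x, (∀ i ∉ Set.range g, x i = w i) → (R x ↔ Q (x ∘ g))) : Controls S Q := by
  intro a b hab
  refine (hR a b hab).ancilla (g.sumMap (Embedding.refl Bool)) (Sum.elim w fun _ => a)
    fun x hx => ⟨condSwap_comp _ (fun _ => rfl) a b ?_, fun i hi => ?_⟩
  · refine h _ fun i hi => hx (.inl i) ?_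
    rintro ⟨j | j, hj⟩
    · exact hi ⟨j, Sum.inl_injective hj⟩
    · cases hj
  · exact condSwap_apply_of_ne _ _ _ _ _ fun c hc => hi ⟨.inr c, hc.symm⟩

end Controls

end CondSwap

section Generation

open Equiv Function

variable {A : Type*} [DecidableEq A] {S : Set (Gate A)} {κ : Type}

theorem swapGate_apply (a b : A) (x : Fin 2 → A) :
    swapGate a b x = if s(x 0, x 1) = s(a, b) then ![x 1, x 0] else x := by
  have hx : x = ![x 0, x 1] := by ext i; fin_cases i <;> rfl
  generalize x 0 = c, x 1 = d at hx
  subst hx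
  unfold swapGate tau
  rw [swap_apply_def]
  have h (a b c d : A) : ![a, b] = ![c, d] ↔ a = c ∧ b = d := by simp
  simp only [h, Sym2.eq_iff]
  split_ifs <;> grind

theorem controlled_swapGate_apply (o a b : A) (x : Fin (1 + 2) → A) :
    controlled ![o] (swapGate a b) x =
      if x 0 = o ∧ s(x 1, x 2) = s(a, b) then ![x 0, x 2, x 1] else x := by
  obtain ⟨⟨p, q⟩, rfl⟩ := (splitEquiv A 1 2).symm.surjective x
  have h₀ (r) : (splitEquiv A 1 2).symm r 0 = r.1 0 := splitEquiv_symm_castAdd r 0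
  have h₁ (r) : (splitEquiv A 1 2).symm r 1 = r.2 0 := splitEquiv_symm_natAdd r 0
  have h₂ (r) : (splitEquiv A 1 2).symm r 2 = r.2 1 := splitEquiv_symm_natAdd r 1
  have hp : p = ![o] ↔ p 0 = o := by
    constructor
    · rintro rfl; rfl
    · rintro h; ext i; fin_cases i; exact h
  simp only [controlled, Equiv.trans_apply, Equiv.apply_symm_apply, Equiv.prodCongrRight_apply,
    hp, h₀, h₁, h₂]
  by_cases hpo : p 0 = o
  · rw [if_pos hpo, swapGate_apply]
    by_cases hq : s(q 0, q 1) = s(a, b)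
    · rw [if_pos hq, if_pos ⟨hpo, hq⟩]
      ext i
      fin_cases i
      · exact h₀ _
      · exact h₁ _
      · exact h₂ _
    · rw [if_neg hq, if_neg fun h => hq h.2]
  · rw [if_neg hpo, if_neg fun h => hpo h.1]
    rfl

namespace Controls

theorem not {Q : (κ → A) → Prop} (hQ : Controls S Q) (hT : Controls S fun _ : κ → A => True) :
    Controls S fun x => ¬ Q x := by
  classical
  intro a b h
  convert (hQ a b h).mul (hT a b h)
  ext x i
  have hl (y : κ ⊕ Bool → A) : (y ∘ Embedding.refl _ ∘ Sum.inl) = y ∘ Sum.inl := rfl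
  have (y : κ ⊕ Bool → A) : (y ∘ swap (.inr false) (.inr true)) ∘ Sum.inl = y ∘ Sum.inl := by
    ext; simp [swap_apply_of_ne_of_ne]
  simp only [Perm.mul_apply, condSwap_apply, true_and, hl, Embedding.refl_apply]
  by_cases hs : s(x (.inr false), x (.inr true)) = s(a, b)
  · have hs' : s(x (.inr true), x (.inr false)) = s(a, b) := Sym2.eq_swap.trans hs
    by_cases hx : Q (x ∘ Sum.inl) <;> simp [hs, hs', hx, this]
  · simp [hs]

variable {o : A}

theorem apply_eq_control [Finite κ]
    (hS : ∀ a b, a ≠ b → Generates S ⟨1 + 2, controlled ![o] (swapGate a b)⟩)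
    (c : κ) : Controls S fun x : κ → A => x c = o := by
  classical
  intro a b h
  let f : Fin (1 + 2) ↪ κ ⊕ Bool := ⟨![.inl c, .inr false, .inr true], by
    intro i j; fin_cases i <;> fin_cases j <;> simp⟩
  refine (GeneratedOn.of_generates (hS a b h)).embed f (fun x => ?_) fun x i hi => ?_
  · rw [condSwap_apply, controlled_swapGate_apply]
    by_cases h : x (.inl c) = o ∧ s(x (.inr false), x (.inr true)) = s(a, b)
    · rw [if_pos (by exact h), if_pos (by exact h)]
      ext i
      fin_cases i
      · exact congrArg x (swap_apply_of_ne_of_ne Sum.inl_ne_inr Sum.inl_ne_inr)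
      · exact congrArg x (swap_apply_left _ _)
      · exact congrArg x (swap_apply_right _ _)
    · rw [if_neg (by exact h), if_neg (by exact h)]
  · refine condSwap_apply_of_ne _ _ _ _ _ fun d hd => hi ?_
    cases d
    · exact ⟨1, hd.symm⟩
    · exact ⟨2, hd.symm⟩

theorem const_true [Finite κ]
    (hS : ∀ a b, a ≠ b → Generates S ⟨1 + 2, controlled ![o] (swapGate a b)⟩) :
    Controls S fun _ : κ → A => True := by
  refine ancilla (ι := κ ⊕ Unit) Embedding.inl (fun _ => o) (apply_eq_control hS (.inr ()))
    fun x hx => ?_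
  simpa using hx (.inr ()) (by simp)

variable [Finite A] {t : A}

theorem and [Finite κ]
    (hS : ∀ a b, a ≠ b → Generates S ⟨1 + 2, controlled ![o] (swapGate a b)⟩) (ht : o ≠ t)
    {P Q : (κ → A) → Prop} (hP : Controls S P) (hQ : Controls S Q) :
    Controls S fun x => P x ∧ Q x := by
  classical
  let f (n : Fin 3) (hn : 0 ≠ n) : κ ⊕ Bool ↪ κ ⊕ Fin 3 :=
    (Embedding.refl κ).sumMap ⟨fun c => cond c n 0, by
      intro c d; cases c <;> cases d <;> simp [hn, hn.symm]⟩
  let F := condSwap P (f 1 (by decide)) o t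
  let G := condSwap Q (f 2 (by decide)) o t
  refine ancilla Embedding.inl (Sum.elim (fun _ => o) ![t, o, t])
    (((apply_eq_control hS (.inr 2)).comp_perm (hQ.generatedOn _ ht : GeneratedOn S G)).comp_perm
    (hP.generatedOn _ ht : GeneratedOn S F)) fun x hx => ?_
  have hx' (i : Fin 3) : x (.inr i) = ![t, o, t] i := hx (.inr i) (by simp)
  have h₀ : x (.inr 0) = t := hx' 0
  have h₁ : x (.inr 1) = o := hx' 1
  have h₂ : x (.inr 2) = t := hx' 2
  have hl (y : κ ⊕ Fin 3 → A) (n hn) : y ∘ f n hn ∘ Sum.inl = y ∘ Sum.inl := rfl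
  have hf (n hn) : f n hn (.inr false) = .inr 0 := rfl
  have hr (n hn) : f n hn (.inr true) = .inr n := rfl
  have hF : F x ∘ Sum.inl = x ∘ Sum.inl := by
    ext i
    exact condSwap_apply_of_ne _ _ _ _ _ fun c => by simp [f]
  have hF₂ : F x (.inr 2) = t := by
    refine (condSwap_apply_of_ne _ _ _ _ _ fun c => ?_).trans h₂
    cases c
    · simp [hf]
    · simp [hr]
  have hF₀ : F x (.inr 0) = o ↔ P (x ∘ Sum.inl) := by
    by_cases hp : P (x ∘ Sum.inl) <;>
      simp_all [F, condSwap_apply, Sym2.eq_swap (a := t) (b := o), ne_comm]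
  have hF₀' : F x (.inr 0) = o ∨ F x (.inr 0) = t := by
    by_cases hp : P (x ∘ Sum.inl) <;>
      simp_all [F, condSwap_apply, Sym2.eq_swap (a := t) (b := o), ne_comm]
  change G (F x) (.inr 2) = o ↔ P (x ∘ Sum.inl) ∧ Q (x ∘ Sum.inl)
  rw [← hF₀]
  simp only [G, condSwap_apply, hl, hf, hr, hF, hF₂]
  have ht' := ht.symm
  split_ifs with h
  · simp_all
  · simp_all
    tauto

theorem apply_eq [Finite κ]
    (hS : ∀ a b, a ≠ b → Generates S ⟨1 + 2, controlled ![o] (swapGate a b)⟩)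
    (c : κ) (a : A) : Controls S fun x : κ → A => x c = a := by
  classical
  by_cases ha : o = a
  · exact ha ▸ apply_eq_control hS c
  let f : Empty ⊕ Bool ↪ κ ⊕ Unit := ⟨Sum.elim Empty.elim fun d => cond d (.inr ()) (.inl c), by
    rintro (⟨⟨⟩⟩ | i) (⟨⟨⟩⟩ | j)
    cases i <;> cases j <;> simp⟩
  have : Controls S fun x : κ → A => x c ≠ a := by
    refine ancilla Embedding.inl (fun _ => o) ((apply_eq_control hS (.inr ())).comp_perm
      ((const_true hS).generatedOn f ha)) fun x hx => ?_
    have hr : x (.inr ()) = o := hx (.inr ()) (by simp)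
    have hf : f (.inr false) = .inl c := rfl
    have ht : f (.inr true) = .inr () := rfl
    simp only [condSwap_apply, hf, ht, hr, true_and, Sym2.eq_iff]
    split_ifs
    · simp_all
      grind
    · simp_all
  simpa using this.not (const_true hS)

theorem forall_mem_apply_eq [Finite κ]
    (hS : ∀ a b, a ≠ b → Generates S ⟨1 + 2, controlled ![o] (swapGate a b)⟩) (ht : o ≠ t)
    (s : Finset κ) (w : κ → A) :
    Controls S fun x => ∀ i ∈ s, x i = w i := by
  classical
  induction s using Finset.induction_on with
  | empty => simpa using const_true hS
  | insert i s _ ih => simpa using and hS ht (apply_eq hS i (w i)) ih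

theorem eq_state [Finite κ]
    (hS : ∀ a b, a ≠ b → Generates S ⟨1 + 2, controlled ![o] (swapGate a b)⟩) (ht : o ≠ t)
    (w : κ → A) : Controls S fun x => x = w := by
  have := Fintype.ofFinite κ
  simpa [funext_iff] using forall_mem_apply_eq hS ht Finset.univ w

end Controls

variable [Finite A] {o t : A}

theorem generatedOn_swap_comp_swap {n : ℕ} (ht : o ≠ t)
    (hS : ∀ a b, a ≠ b → Generates S ⟨1 + 2, controlled ![o] (swapGate a b)⟩)
    (u : Fin n → A) {p q : Fin n} (hpq : p ≠ q) :
    GeneratedOn S (swap u (u ∘ swap p q)) := by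
  by_cases hu : u p = u q
  · have : u ∘ swap p q = u := by
      ext i
      simp only [comp_apply, swap_apply_def]
      split_ifs <;> simp [*]
    rw [this, swap_self]
    exact GeneratedOn.one
  let f : {i // i ≠ p ∧ i ≠ q} ⊕ Bool ↪ Fin n :=
    ⟨Sum.elim Subtype.val fun d => cond d q p, by
      rintro (⟨i, hi⟩ | i) (⟨j, hj⟩ | j)
      · simp
      · cases j <;> simp [hi]
      · cases i <;> simp [hj.1.symm, hj.2.symm]
      · cases i <;> cases j <;> simp [hpq, hpq.symm]⟩
  have hl (y : Fin n → A) : y ∘ f ∘ Sum.inl = fun i => y i.1 := rfl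
  have hf : f (.inr false) = p := rfl
  have hq : f (.inr true) = q := rfl
  convert! (Controls.eq_state hS ht fun i => u i.1).generatedOn f hu
  ext1 x
  rw [condSwap_apply, hl, hf, hq]
  by_cases h₁ : x = u
  · subst h₁
    simp
  by_cases h₂ : x = u ∘ swap p q
  · subst h₂
    rw [swap_apply_right, if_pos]
    · ext; simp [swap_apply_self]
    · refine ⟨?_, by simp [Sym2.eq_swap]⟩
      ext i
      simp [swap_apply_of_ne_of_ne i.2.1 i.2.2]
  rw [swap_apply_of_ne_of_ne h₁ h₂, if_neg]
  rintro ⟨h, hs⟩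
  have h (i) (hp : i ≠ p) (hq : i ≠ q) : x i = u i := congrFun h ⟨i, hp, hq⟩
  obtain ⟨hp, hq⟩ | ⟨hp, hq⟩ := Sym2.eq_iff.1 hs
  · refine h₁ (funext fun i => ?_)
    by_cases hip : i = p
    · rw [hip, hp]
    by_cases hiq : i = q
    · rw [hiq, hq]
    exact h i hip hiq
  · refine h₂ (funext fun i => ?_)
    by_cases hip : i = p
    · simp [hip, hp]
    by_cases hiq : i = q
    · simp [hiq, hq]
    simp [swap_apply_of_ne_of_ne hip hiq, h i hip hiq]

theorem Generates.of_isConservative {g : Gate A} (ht : o ≠ t)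
    (hS : ∀ a b, a ≠ b → Generates S ⟨1 + 2, controlled ![o] (swapGate a b)⟩)
    (hg : IsConservative g) : Generates S g := by
  obtain ⟨n, F⟩ := g
  let H : Subgroup (Perm (Fin n → A)) :=
    { carrier := {F | GeneratedOn S F}
      mul_mem' := GeneratedOn.mul
      one_mem' := GeneratedOn.one
      inv_mem' := GeneratedOn.inv }
  have hH (u : Fin n → A) (σ : Perm (Fin n)) : swap u (u ∘ σ) ∈ H := by
    induction σ using Perm.swap_induction_on generalizing u with
    | one => exact (swap_self u).symm ▸ H.one_mem
    | swap_mul σ p q hpq ih =>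
      exact SubmonoidClass.swap_mem_trans H (generatedOn_swap_comp_swap ht hS u hpq)
        (ih (u ∘ swap p q))
  let T : Set (Perm (Fin n → A)) := {τ | τ.IsSwap ∧ τ ∈ H}
  have hF : F ∈ Subgroup.closure T := by
    refine (mem_closure_isSwap fun _ h => h.1).2 ⟨Set.toFinite _, fun x => ?_⟩
    by_cases hx : F x = x
    · rw [hx]
      exact MulAction.mem_orbit_self x
    obtain ⟨σ, hσ⟩ := exists_perm_of_countOf_eq (hg x)
    refine ⟨⟨swap x (F x), Subgroup.subset_closure ⟨⟨x, F x, Ne.symm hx, rfl⟩, ?_⟩⟩,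
      swap_apply_left x (F x)⟩
    exact hσ ▸ hH x σ
  exact ((Subgroup.closure_le H).2 (fun _ h => h.2) hF : GeneratedOn S F).generates_fin

end Generation

/-- Over `A = {1,…,k}` with `k ≥ 3`, the set `S` of gates `1-SWAP_{a,b}` for all
`a ≠ b ∈ A` generates exactly the class `CONS` of all conservative gates
(here the symbol `1` is `⟨0,_⟩ : Fin k`). -/
theorem closure_eq_cons (k : ℕ) (hk : 3 ≤ k) :
    genClosure {g : Gate (Fin k) | ∃ a b : Fin k, a ≠ b ∧
      g = ⟨1 + 2, controlled ![(⟨0, by omega⟩ : Fin k)] (swapGate a b)⟩} =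
      {g : Gate (Fin k) | ∀ (x : Fin g.1 → Fin k) (a : Fin k),
        countOf a (g.2 x) = countOf a x} := by
  ext g
  refine ⟨fun hg => Generates.isConservative ?_ hg, fun hg => ?_⟩
  · rintro _ ⟨a, b, -, rfl⟩
    exact isConservative_controlled _ fun x c => countOf_swapGate a b c x
  · refine Generates.of_isConservative (o := ⟨0, by omega⟩) (t := ⟨1, by omega⟩) ?_ ?_ hg
    · rw [Ne, Fin.mk.injEq]
      exact zero_ne_one
    · exact fun a b h => .mem ⟨a, b, h, rfl⟩
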